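/- arXiv:2102.11754 — 4 statements merged into one kernel-verified Lean document; each statement's English description precedes it below -/
import Mathlib

section
/- Let σ₁, σ₂, ρ, μ₁, μ₂ be real numbers with σ₁ > 0, σ₂ > 0, σ₁σ₂ − ρ² > 0 (so θ = (σ₁ + σ₂ − 2ρ)/2 > 0) and σ₂ ≠ ρ. Let q be a real number and let x, y be real numbers with y ≠ 0 such that U(x + iy, q) = 0 (so x ± iy are the two complex conjugate roots of the quadratic U(·, q)). Then (x, y) lies on the hyperbola (ρ² − σ₁σ₂)x² + (σ₂ − ρ)²y² + 2(σ₂μ₁ − ρμ₂)x + (μ₂ − μ₁)(σ₂(μ₁ + μ₂) − 2ρμ₂)/(2θ) = 0. -/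
open Complex

/-- If `x ± iy` (with `y ≠ 0`) are the complex conjugate roots of the quadratic
`U(·, q)` for a real `q`, then `(x, y)` lies on the hyperbola `ℋᵘ`. -/
theorem hyperbola_Hu (σ₁ σ₂ ρ μ₁ μ₂ θ : ℝ)
    (h₁ : σ₁ > 0) (h₂ : σ₂ > 0) (hell : σ₁ * σ₂ - ρ ^ 2 > 0)
    (hθ : θ = (σ₁ + σ₂ - 2 * ρ) / 2) (hσρ : σ₂ ≠ ρ)
    (q x y : ℝ) (hy : y ≠ 0)
    (hroot : (θ : ℂ) * ((x : ℂ) + (y : ℂ) * I) ^ 2 + (σ₂ : ℂ) / 2 * (q : ℂ) ^ 2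
        + ((σ₂ : ℂ) - (ρ : ℂ)) * ((x : ℂ) + (y : ℂ) * I) * (q : ℂ)
        + ((μ₂ : ℂ) - (μ₁ : ℂ)) * ((x : ℂ) + (y : ℂ) * I) + (μ₂ : ℂ) * (q : ℂ) = 0) :
    (ρ ^ 2 - σ₁ * σ₂) * x ^ 2 + (σ₂ - ρ) ^ 2 * y ^ 2 + 2 * (σ₂ * μ₁ - ρ * μ₂) * x
      + (μ₂ - μ₁) * (σ₂ * (μ₁ + μ₂) - 2 * ρ * μ₂) / (2 * θ) = 0 := by
  have hθ_pos : 0 < θ := by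
    have h : 0 < σ₂ * θ := by
      rw [hθ]
      nlinarith [sq_nonneg (σ₂ - ρ)]
    exact pos_of_mul_pos_right h h₂.le
  -- The kernel equation at `x + iy` with all coefficients real, split into components.
  have hsplit : ((θ * (x ^ 2 - y ^ 2) + σ₂ / 2 * q ^ 2 + (σ₂ - ρ) * x * q
      + (μ₂ - μ₁) * x + μ₂ * q : ℝ) : ℂ)
      + ((y * (2 * θ * x + (σ₂ - ρ) * q + (μ₂ - μ₁)) : ℝ) : ℂ) * I = 0 := by
    push_cast
    linear_combination hroot - (θ : ℂ) * (y : ℂ) ^ 2 * I_sq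
  have hre : θ * (x ^ 2 - y ^ 2) + σ₂ / 2 * q ^ 2 + (σ₂ - ρ) * x * q
      + (μ₂ - μ₁) * x + μ₂ * q = 0 := by
    simpa only [add_re, re_ofReal_mul, ofReal_re, I_re, mul_zero, add_zero, zero_re]
      using congrArg re hsplit
  have him : 2 * θ * x + (σ₂ - ρ) * q + (μ₂ - μ₁) = 0 := by
    have h : y * (2 * θ * x + (σ₂ - ρ) * q + (μ₂ - μ₁)) = 0 := by
      simpa only [add_im, im_ofReal_mul, ofReal_im, I_im, mul_one, zero_add, zero_im]
        using congrArg im hsplit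
    exact (mul_eq_zero.mp h).resolve_left hy
  -- Eliminate `q` between the two components.
  field_simp
  linear_combination (-2 * (σ₂ - ρ) ^ 2) * hre + 4 * σ₂ * θ * x ^ 2 * hθ
    + 2 * ((σ₂ - ρ) ^ 2 * x + σ₂ / 2 * ((σ₂ - ρ) * q - (2 * θ * x + (μ₂ - μ₁)))
      + μ₂ * (σ₂ - ρ)) * him
end

section
/- Let σ₁, σ₂, ρ be real numbers with σ₁ > 0, σ₂ > 0 and σ₁σ₂ − ρ² > 0 (ellipticity), and set θ = (σ₁ + σ₂ − 2ρ)/2. Then for all real numbers x and β, the quadratic expression θβ² + (σ₂ − ρ)xβ + (σ₂/2)x² is nonnegative, and it equals zero only when x = 0 and β = 0. Consequently, for any real μ₁, μ₂, every root α + iβ (α, β real) of U(·, ix) with x real satisfies θα² + (μ₂ − μ₁)α ≥ 0. -/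
open Complex

/-- Under ellipticity, the quadratic `θβ² + (σ₂ − ρ)xβ + (σ₂/2)x²` is nonnegative and
vanishes only at `x = β = 0`; consequently every root `α + iβ` of `U(·, ix)` with
`x` real satisfies `θα² + (μ₂ − μ₁)α ≥ 0`. -/
theorem quadratic_positivity (σ₁ σ₂ ρ θ : ℝ)
    (h₁ : σ₁ > 0) (h₂ : σ₂ > 0) (hell : σ₁ * σ₂ - ρ ^ 2 > 0)
    (hθ : θ = (σ₁ + σ₂ - 2 * ρ) / 2) :
    (∀ x β : ℝ,
      0 ≤ θ * β ^ 2 + (σ₂ - ρ) * x * β + σ₂ / 2 * x ^ 2 ∧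
      (θ * β ^ 2 + (σ₂ - ρ) * x * β + σ₂ / 2 * x ^ 2 = 0 → x = 0 ∧ β = 0)) ∧
    (∀ μ₁ μ₂ x α β : ℝ,
      (θ : ℂ) * ((α : ℂ) + (β : ℂ) * I) ^ 2 + (σ₂ : ℂ) / 2 * ((x : ℂ) * I) ^ 2
          + ((σ₂ : ℂ) - (ρ : ℂ)) * ((α : ℂ) + (β : ℂ) * I) * ((x : ℂ) * I)
          + ((μ₂ : ℂ) - (μ₁ : ℂ)) * ((α : ℂ) + (β : ℂ) * I) + (μ₂ : ℂ) * ((x : ℂ) * I) = 0 →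
        θ * α ^ 2 + (μ₂ - μ₁) * α ≥ 0) := by
  have complete_square (x β : ℝ) :
      2 * σ₂ * (θ * β ^ 2 + (σ₂ - ρ) * x * β + σ₂ / 2 * x ^ 2)
        = (σ₂ * x + (σ₂ - ρ) * β) ^ 2 + (σ₁ * σ₂ - ρ ^ 2) * β ^ 2 := by
    rw [hθ]; ring
  have nonneg (x β : ℝ) : 0 ≤ θ * β ^ 2 + (σ₂ - ρ) * x * β + σ₂ / 2 * x ^ 2 := by
    refine (mul_nonneg_iff_of_pos_left (c := 2 * σ₂) (by positivity)).mp ?_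
    rw [complete_square]
    positivity
  refine ⟨fun x β => ⟨nonneg x β, fun h => ?_⟩, fun μ₁ μ₂ x α β h => ?_⟩
  · have hsq := complete_square x β
    rw [h, mul_zero] at hsq
    have hβ : β = 0 := by
      by_contra hne
      have : 0 < (σ₁ * σ₂ - ρ ^ 2) * β ^ 2 := by positivity
      linarith [sq_nonneg (σ₂ * x + (σ₂ - ρ) * β)]
    subst hβ
    have hx : σ₂ * x = 0 := by simpa using hsq.symm
    exact ⟨(mul_eq_zero.mp hx).resolve_left h₂.ne', rfl⟩
  · have hre : θ * α ^ 2 + (μ₂ - μ₁) * α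
        = θ * β ^ 2 + (σ₂ - ρ) * x * β + σ₂ / 2 * x ^ 2 := by
      have := congrArg Complex.re h
      simp [pow_two] at this
      linarith
    rw [hre]
    exact nonneg x β
end

section
/- Let σ, ρ, μ be real numbers with σ > 0 and |ρ| < σ. Let p be a real number and let x, y be real numbers with y ≠ 0 such that U(p, x + iy) = 0 (so the quadratic U(p, ·) in q has the complex conjugate roots x ± iy). Then (σ + ρ)x² − (σ − ρ)y² + 4μx + 2μ²/σ = 0. -/
open Complex

/-- Symmetric case: if `x ± iy` (with `y ≠ 0`) are the complex conjugate roots of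
the quadratic `U(p, ·)` for a real `p`, then `(x, y)` lies on the hyperbola `ℋ_q`. -/
theorem hyperbola_Hq_symmetric (σ ρ μ : ℝ)
    (hσ : σ > 0) (hρ : |ρ| < σ)
    (p x y : ℝ) (hy : y ≠ 0)
    (hroot : ((σ : ℂ) - (ρ : ℂ)) * (p : ℂ) ^ 2
        + ((σ : ℂ) - (ρ : ℂ)) * ((x : ℂ) + (y : ℂ) * I) * (p : ℂ)
        + (σ : ℂ) / 2 * ((x : ℂ) + (y : ℂ) * I) ^ 2
        + (μ : ℂ) * ((x : ℂ) + (y : ℂ) * I) = 0) :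
    (σ + ρ) * x ^ 2 - (σ - ρ) * y ^ 2 + 4 * μ * x + 2 * μ ^ 2 / σ = 0 := by
  have hre : (σ - ρ) * p ^ 2 + (σ - ρ) * x * p + σ / 2 * (x ^ 2 - y ^ 2) + μ * x = 0 := by
    have h := congrArg Complex.re hroot
    simp [pow_two] at h
    linarith
  have him : y * ((σ - ρ) * p + σ * x + μ) = 0 := by
    have h := congrArg Complex.im hroot
    simp [pow_two] at h
    linarith
  have hp : (σ - ρ) * p + σ * x + μ = 0 := (mul_eq_zero.mp him).resolve_left hy
  have hσ₀ : σ ≠ 0 := hσ.ne'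
  field_simp
  linear_combination 2 * (σ - ρ) * hre -
    2 * ((σ - ρ) * p - σ * x - μ + (σ - ρ) * x) * hp
end

section
/- Let σ, ρ, μ be real numbers with σ > 0 and |ρ| < σ. Let q be a real number and let x, y be real numbers with y ≠ 0 such that U(x + iy, q) = 0 (so the quadratic U(·, q) in p has the complex conjugate roots x ± iy). Then (x − μ/(σ + ρ))² − ((σ − ρ)/(σ + ρ))y² = (μ/(σ + ρ))², equivalently (σ + ρ)x² − (σ − ρ)y² − 2μx = 0. -/
open Complex

/-- Symmetric case: if `x ± iy` (with `y ≠ 0`) are the complex conjugate roots of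
the quadratic `U(·, q)` for a real `q`, then `(x, y)` lies on the hyperbola `ℋ_p`,
which passes through the origin. -/
theorem hyperbola_Hp_symmetric (σ ρ μ : ℝ)
    (hσ : σ > 0) (hρ : |ρ| < σ)
    (q x y : ℝ) (hy : y ≠ 0)
    (hroot : ((σ : ℂ) - (ρ : ℂ)) * ((x : ℂ) + (y : ℂ) * I) ^ 2
        + ((σ : ℂ) - (ρ : ℂ)) * (q : ℂ) * ((x : ℂ) + (y : ℂ) * I)
        + (σ : ℂ) / 2 * (q : ℂ) ^ 2 + (μ : ℂ) * (q : ℂ) = 0) :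
    (x - μ / (σ + ρ)) ^ 2 - (σ - ρ) / (σ + ρ) * y ^ 2 = (μ / (σ + ρ)) ^ 2 ∧
    (σ + ρ) * x ^ 2 - (σ - ρ) * y ^ 2 - 2 * μ * x = 0 := by
  obtain ⟨hρ_neg, hρ_pos⟩ := abs_lt.mp hρ
  have hsum : σ + ρ ≠ 0 := by linarith
  have hdiff : σ - ρ ≠ 0 := by linarith
  have hsplit : (((σ - ρ) * (x ^ 2 - y ^ 2) + (σ - ρ) * q * x + σ / 2 * q ^ 2 + μ * q : ℝ) : ℂ)
      + (((σ - ρ) * y * (2 * x + q) : ℝ) : ℂ) * I = 0 := by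
    rw [← hroot]
    push_cast
    linear_combination (-((σ : ℂ) - ρ) * y ^ 2) * I_sq
  have hre := congrArg re hsplit
  have him := congrArg im hsplit
  simp only [add_re, re_ofReal_mul, ofReal_re, I_re, mul_zero, add_zero, zero_re] at hre
  simp only [add_im, im_ofReal_mul, ofReal_im, I_im, mul_one, zero_add, zero_im] at him
  have hq : q = -2 * x := by
    have := (mul_eq_zero.mp him).resolve_left (mul_ne_zero hdiff hy)
    linarith
  subst hq
  have hconic : (σ + ρ) * x ^ 2 - (σ - ρ) * y ^ 2 - 2 * μ * x = 0 := by
    linear_combination hre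
  refine ⟨?_, hconic⟩
  field_simp
  linear_combination (σ + ρ) * hconic
end
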